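/- Let X be a second countable, locally compact Hausdorff space, H_X an X-module, and fix a metric d on the one-point compactification X⁺ compatible with its topology. For a bounded norm-continuous function T : [1,∞) → 𝓛(H_X), the following are equivalent: (1) lim_{t→∞} ‖[φ, T_t]‖ = 0 for every φ ∈ C₀(X); (2) there is a bounded norm-continuous S : [1,∞) → 𝓛(H_X) with lim_{t→∞} ‖T_t − S_t‖ = 0 and prop(S_t) → 0 as t → ∞, where propagation is measured with respect to d, viewing H_X as an X⁺-module; (3) there is a bounded norm-continuous S : [1,∞) → 𝓛(H_X) with lim_{t→∞} ‖T_t − S_t‖ = 0 such that for every open neighbourhood U of the diagonal in X⁺ × X⁺ there exists t_U ≥ 1 with supp(S_t) ⊆ U for all t > t_U. The same equivalences hold when 'bounded norm-continuous 𝓛(H_X)-valued' is replaced throughout by 'bounded uniformly norm-continuous 𝓛(H_X)-valued', by 'bounded norm-continuous 𝒦(H_X)-valued', or by 'bounded uniformly norm-continuous 𝒦(H_X)-valued'. -/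

import Mathlib

open scoped ZeroAtInfty
open Filter Topology MeasureTheory

noncomputable section

namespace Stmt

variable {X : Type*} [TopologicalSpace X]
variable {H : Type*} [NormedAddCommGroup H] [InnerProductSpace ℂ H] [CompleteSpace H]

/-- `π` is a nondegenerate ⋆-representation of `C₀(X, ℂ)` on the Hilbert space `H`,
i.e. `H` is an `X`-module. -/
structure IsStarRep (π : C₀(X, ℂ) → H →L[ℂ] H) : Prop where
  map_add : ∀ φ ψ, π (φ + ψ) = π φ + π ψ
  map_smul : ∀ (a : ℂ) (φ), π (a • φ) = a • π φ
  map_mul : ∀ φ ψ, π (φ * ψ) = (π φ).comp (π ψ)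
  map_star : ∀ φ, ContinuousLinearMap.adjoint (π φ) = π (star φ)
  nondeg : Dense (↑(Submodule.span ℂ (Set.range fun p : C₀(X, ℂ) × H => π p.1 p.2)) : Set H)

/-- The function `x ↦ f x - f ∞` on `X`, for `f` a continuous function on the one-point
compactification of `X`; it vanishes at infinity. -/
def onePointRestrict (f : C(OnePoint X, ℂ)) : C₀(X, ℂ) where
  toFun x := f x - f OnePoint.infty
  continuous_toFun := (f.continuous.comp OnePoint.continuous_coe).sub continuous_const
  zero_at_infty' := by
    have h1 : Tendsto ((↑) : X → OnePoint X) (cocompact X) (𝓝 (OnePoint.infty)) :=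
      OnePoint.tendsto_coe_infty.mono_left cocompact_le_coclosedCompact
    have h2 : Tendsto (fun x : X => f x - f OnePoint.infty) (cocompact X)
        (𝓝 (f OnePoint.infty - f OnePoint.infty)) :=
      ((f.continuous.tendsto _).comp h1).sub tendsto_const_nhds
    simpa using h2

/-- The canonical action of `C(X⁺, ℂ)` on an `X`-module, extending the action of
`C₀(X, ℂ)` unitally (`X⁺` being the one-point compactification of `X`). -/
def onePointAct (π : C₀(X, ℂ) → H →L[ℂ] H) (f : C(OnePoint X, ℂ)) : H →L[ℂ] H :=
  f OnePoint.infty • (1 : H →L[ℂ] H) + π (onePointRestrict f)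

/-- The support of an operator on an `X`-module, viewed as a module over the one-point
compactification `X⁺`: the set of pairs `(y, x) ∈ X⁺ × X⁺` such that every pair of
neighbourhoods of `x` and `y` carries test functions `f, g` with `g T f ≠ 0`. -/
def opSupportPlus (π : C₀(X, ℂ) → H →L[ℂ] H) (T : H →L[ℂ] H) :
    Set (OnePoint X × OnePoint X) :=
  {p | ∀ U V : Set (OnePoint X), IsOpen U → IsOpen V → p.2 ∈ U → p.1 ∈ V →
      ∃ f g : C(OnePoint X, ℂ), tsupport ⇑f ⊆ U ∧ tsupport ⇑g ⊆ V ∧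
        (onePointAct π g).comp (T.comp (onePointAct π f)) ≠ 0}

/-- A metric on a topological space `Z`, compatible with its topology. -/
structure CompatMetric (Z : Type*) [TopologicalSpace Z] where
  d : Z → Z → ℝ
  refl : ∀ z, d z z = 0
  eq_of_d : ∀ {a b : Z}, d a b = 0 → a = b
  symm : ∀ a b, d a b = d b a
  triangle : ∀ a b c, d a c ≤ d a b + d b c
  compat : ∀ s : Set Z, IsOpen s ↔ ∀ z ∈ s, ∃ ε > (0 : ℝ), {w | d z w < ε} ⊆ s

/-- A family of operators indexed by `[1, ∞)` (modelled on `ℝ`) is bounded in norm. -/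
def OpBdd (T : ℝ → H →L[ℂ] H) : Prop :=
  ∃ C : ℝ, ∀ t : ℝ, 1 ≤ t → ‖T t‖ ≤ C

/-- Condition (1): `lim_{t → ∞} ‖[φ, T_t]‖ = 0` for every `φ ∈ C₀(X)`. -/
def CommDecay (π : C₀(X, ℂ) → H →L[ℂ] H) (T : ℝ → H →L[ℂ] H) : Prop :=
  ∀ φ : C₀(X, ℂ),
    Tendsto (fun t => ‖(π φ).comp (T t) - (T t).comp (π φ)‖) atTop (𝓝 0)

/-- `prop(S_t) → 0` as `t → ∞`, with respect to a metric `D` on `X⁺` (propagation being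
measured via the support in `X⁺ × X⁺`). -/
def PropDecayPlus (π : C₀(X, ℂ) → H →L[ℂ] H) (D : CompatMetric (OnePoint X))
    (S : ℝ → H →L[ℂ] H) : Prop :=
  ∀ ε > (0 : ℝ), ∃ t₀ : ℝ, ∀ t ≥ t₀, ∀ p ∈ opSupportPlus π (S t), D.d p.1 p.2 ≤ ε

/-- Condition (3): for every open neighbourhood `U` of the diagonal in `X⁺ × X⁺` there is
`t_U ≥ 1` such that `supp (S_t) ⊆ U` for all `t > t_U`. -/
def SmallSuppPlus (π : C₀(X, ℂ) → H →L[ℂ] H) (S : ℝ → H →L[ℂ] H) : Prop :=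
  ∀ U : Set (OnePoint X × OnePoint X), IsOpen U → (∀ z, (z, z) ∈ U) →
    ∃ tU : ℝ, 1 ≤ tU ∧ ∀ t > tU, opSupportPlus π (S t) ⊆ U

/-- Condition (2) resp. (3): `T` can be approximated (uniformly as `t → ∞`) by a bounded
family `S` in the continuity class `cls` and value class `val`, satisfying `P S`. -/
def ApproxBy (T : ℝ → H →L[ℂ] H) (cls : (ℝ → H →L[ℂ] H) → Prop)
    (val : (ℝ → H →L[ℂ] H) → Prop) (P : (ℝ → H →L[ℂ] H) → Prop) : Prop :=
  ∃ S : ℝ → H →L[ℂ] H, OpBdd S ∧ cls S ∧ val S ∧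
    Tendsto (fun t => ‖T t - S t‖) atTop (𝓝 0) ∧ P S

section CompactHausdorff

variable {Z : Type*} [TopologicalSpace Z]

/-- A real-valued continuous function regarded as a complex-valued one. -/
def complexify (f : C(Z, ℝ)) : C(Z, ℂ) where
  toFun x := (f x : ℂ)
  continuous_toFun := Complex.continuous_ofReal.comp f.continuous

@[simp]
lemma complexify_apply (f : C(Z, ℝ)) (x : Z) : complexify f x = (f x : ℂ) := rfl

lemma tsupport_complexify (f : C(Z, ℝ)) : tsupport ⇑(complexify f) = tsupport ⇑f := by
  have : Function.support ⇑(complexify f) = Function.support ⇑f := by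
    ext x; simp
  rw [tsupport, tsupport, this]

lemma norm_le_one_of_mem_unitInterval [CompactSpace Z] {f : C(Z, ℝ)} (h0 : ∀ x, 0 ≤ f x)
    (h1 : ∀ x, f x ≤ 1) : ‖complexify f‖ ≤ 1 := by
  rw [ContinuousMap.norm_le _ zero_le_one]
  intro x
  simpa [abs_of_nonneg (h0 x)] using h1 x

lemma exists_finite_partition [CompactSpace Z] [T2Space Z] {ι : Type*} [Fintype ι] {s : Set Z}
    (hs : IsClosed s) (U : ι → Set Z) (hU : ∀ i, IsOpen (U i)) (hsU : s ⊆ ⋃ i, U i) :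
    ∃ φ : ι → C(Z, ℝ), (∀ i, tsupport ⇑(φ i) ⊆ U i) ∧ (∀ i x, 0 ≤ φ i x) ∧
      (∀ x ∈ s, ∑ i, φ i x = 1) ∧ ∀ x, ∑ i, φ i x ≤ 1 := by
  obtain ⟨p, hp⟩ := PartitionOfUnity.exists_isSubordinate hs U hU hsU
  refine ⟨fun i => p i, hp, fun i x => p.nonneg i x, fun x hx => ?_, fun x => ?_⟩
  · rw [← finsum_eq_sum_of_fintype]; exact p.sum_eq_one hx
  · rw [← finsum_eq_sum_of_fintype]; exact p.sum_le_one x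

lemma map_eq_zero_of_locally [CompactSpace Z] [T2Space Z] {E ι : Type*} [AddCommMonoid E]
    [Fintype ι] (L : C(Z, ℂ) →+ E) (f : C(Z, ℂ)) (U : ι → Set Z) (hU : ∀ i, IsOpen (U i))
    (hfU : tsupport ⇑f ⊆ ⋃ i, U i) (h : ∀ i (f' : C(Z, ℂ)), tsupport ⇑f' ⊆ U i → L f' = 0) :
    L f = 0 := by
  obtain ⟨φ, hφU, -, hφ1, -⟩ := exists_finite_partition (isClosed_tsupport f) U hU hfU
  have hf : f = ∑ i, complexify (φ i) * f := by
    ext x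
    by_cases hx : x ∈ tsupport ⇑f
    · have h1 : ∑ i, (φ i x : ℂ) = 1 := by exact_mod_cast hφ1 x hx
      simp [ContinuousMap.sum_apply, ← Finset.sum_mul, h1]
    · simp [ContinuousMap.sum_apply, image_eq_zero_of_notMem_tsupport hx]
  rw [hf, map_sum]
  refine Finset.sum_eq_zero fun i _ => h i _ ?_
  refine (tsupport_mul_subset_left (f := ⇑(complexify (φ i))) (g := ⇑f)).trans ?_
  rw [tsupport_complexify]
  exact hφU i

lemma bilin_eq_zero_of_locally [CompactSpace Z] [T2Space Z] {E : Type*} [AddCommMonoid E]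
    (B : C(Z, ℂ) →+ C(Z, ℂ) →+ E) (g f : C(Z, ℂ))
    (h : ∀ y ∈ tsupport ⇑g, ∀ x ∈ tsupport ⇑f, ∃ U V : Set Z, IsOpen U ∧ IsOpen V ∧ x ∈ U ∧ y ∈ V ∧
      ∀ f' g' : C(Z, ℂ), tsupport ⇑f' ⊆ U → tsupport ⇑g' ⊆ V → B g' f' = 0) :
    B g f = 0 := by
  have key : ∀ y ∈ tsupport ⇑g, ∃ V : Set Z, IsOpen V ∧ y ∈ V ∧
      ∀ g' : C(Z, ℂ), tsupport ⇑g' ⊆ V → B g' f = 0 := by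
    intro y hy
    choose! U V hUo hVo hxU hyV hB using h y hy
    obtain ⟨t, ht, htU⟩ := (isClosed_tsupport f).isCompact.elim_nhds_subcover U
      fun x hx => (hUo x hx).mem_nhds (hxU x hx)
    refine ⟨⋂ x ∈ t, V x, isOpen_biInter_finset fun x hx => hVo x (ht x hx),
      Set.mem_iInter₂.2 fun x hx => hyV x (ht x hx), fun g' hg' => ?_⟩
    refine map_eq_zero_of_locally (B g') f (fun x : t => U x) (fun x => hUo x (ht x x.2)) ?_
      fun x f' hf' => hB x (ht x x.2) f' g' hf' (hg'.trans (Set.biInter_subset_of_mem x.2))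
    simpa [Set.iUnion_subtype] using htU
  choose! V hVo hyV hB using key
  obtain ⟨t, ht, htV⟩ := (isClosed_tsupport g).isCompact.elim_nhds_subcover V
    fun y hy => (hVo y hy).mem_nhds (hyV y hy)
  refine map_eq_zero_of_locally (B.flip f) g (fun y : t => V y) (fun y => hVo y (ht y y.2)) ?_
    fun y g' hg' => hB y (ht y y.2) g' hg'
  simpa [Set.iUnion_subtype] using htV

variable {H : Type*} [NormedAddCommGroup H] [InnerProductSpace ℂ H] [CompleteSpace H]
variable (ρ : C(Z, ℂ) →⋆ₐ[ℂ] (H →L[ℂ] H))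

/-- The biadditive compression `(g, f) ↦ ρ(g) T ρ(f)`. -/
def compression (T : H →L[ℂ] H) : C(Z, ℂ) →+ C(Z, ℂ) →+ (H →L[ℂ] H) :=
  AddMonoidHom.mk' (fun g => AddMonoidHom.mk' (fun f => ρ g * T * ρ f) fun a b => by
    rw [map_add, mul_add]) fun a b => by
    ext1 f; simp [add_mul]

@[simp]
lemma compression_apply (T : H →L[ℂ] H) (g f : C(Z, ℂ)) :
    compression ρ T g f = ρ g * T * ρ f := rfl

/-- Compressions of `T` to supports at distance more than `ε` from each other vanish. -/
def Controlled (D : CompatMetric Z) (ε : ℝ) (T : H →L[ℂ] H) : Prop :=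
  ∀ g f : C(Z, ℂ), (∀ y ∈ tsupport ⇑g, ∀ x ∈ tsupport ⇑f, ε < D.d y x) → ρ g * T * ρ f = 0

lemma Controlled.mono {ρ : C(Z, ℂ) →⋆ₐ[ℂ] (H →L[ℂ] H)} {D : CompatMetric Z}
    {ε δ : ℝ} {T : H →L[ℂ] H} (h : Controlled ρ D ε T)
    (hεδ : ε ≤ δ) : Controlled ρ D δ T :=
  fun g f hgf => h g f fun y hy x hx => hεδ.trans_lt (hgf y hy x hx)

lemma Controlled.combo {ρ : C(Z, ℂ) →⋆ₐ[ℂ] (H →L[ℂ] H)} {D : CompatMetric Z}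
    {ε : ℝ} {S T : H →L[ℂ] H} (hS : Controlled ρ D ε S)
    (hT : Controlled ρ D ε T) (a b : ℝ) : Controlled ρ D ε (a • S + b • T) := by
  intro g f hgf
  rw [mul_add, add_mul, mul_smul_comm, mul_smul_comm, smul_mul_assoc, smul_mul_assoc,
    hS g f hgf, hT g f hgf, smul_zero, smul_zero, add_zero]

variable [CompactSpace Z]

lemma norm_rep_le (f : C(Z, ℂ)) : ‖ρ f‖ ≤ ‖f‖ := NonUnitalStarAlgHom.norm_apply_le ρ f

lemma sum_norm_sq_rep_le {ι : Type*} [Fintype ι] (h : ι → C(Z, ℝ)) (h0 : ∀ i x, 0 ≤ h i x)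
    (h1 : ∀ x, ∑ i, h i x ≤ 1) (ξ : H) :
    ∑ i, ‖ρ (complexify (h i)) ξ‖ ^ 2 ≤ ‖ξ‖ ^ 2 := by
  set k : C(Z, ℝ) := ∑ i, h i * h i with hk
  have hkx : ∀ x, k x = ∑ i, h i x * h i x := fun x => by simp [hk, ContinuousMap.sum_apply]
  have hk1 : ‖complexify k‖ ≤ 1 := by
    refine norm_le_one_of_mem_unitInterval (fun x => ?_) fun x => ?_
    · rw [hkx]; exact Finset.sum_nonneg fun i _ => mul_self_nonneg _
    · rw [hkx]
      refine (Finset.sum_le_sum fun i _ => ?_).trans (h1 x)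
      have : h i x ≤ 1 :=
        (Finset.single_le_sum (f := fun i => h i x) (fun j _ => h0 j x)
          (Finset.mem_univ i)).trans (h1 x)
      nlinarith [h0 i x]
  have hsq : ∀ i, ‖ρ (complexify (h i)) ξ‖ ^ 2
      = RCLike.re (inner ℂ ξ (ρ (complexify (h i) * complexify (h i)) ξ)) := by
    intro i
    have hstar : star (complexify (h i)) = complexify (h i) := by
      ext x; simp
    have hadj : ContinuousLinearMap.adjoint (ρ (complexify (h i))) = ρ (complexify (h i)) := by
      rw [← ContinuousLinearMap.star_eq_adjoint, ← map_star, hstar]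
    rw [map_mul, mul_apply_eq_comp, ← ContinuousLinearMap.adjoint_inner_left, hadj,
      inner_self_eq_norm_sq]
  have hkc : complexify k = ∑ i, complexify (h i) * complexify (h i) := by
    ext x
    simp [hkx, ContinuousMap.sum_apply]
  calc ∑ i, ‖ρ (complexify (h i)) ξ‖ ^ 2
      = RCLike.re (inner ℂ ξ (ρ (complexify k) ξ)) := by
        simp_rw [hsq]
        rw [hkc, map_sum, _root_.sum_apply, inner_sum, map_sum]
    _ ≤ ‖inner ℂ ξ (ρ (complexify k) ξ)‖ := RCLike.re_le_norm _
    _ ≤ ‖ξ‖ * (‖ρ (complexify k)‖ * ‖ξ‖) :=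
        (norm_inner_le_norm _ _).trans (by gcongr; exact ContinuousLinearMap.le_opNorm _ _)
    _ ≤ ‖ξ‖ * (1 * ‖ξ‖) := by gcongr; exact (norm_rep_le ρ _).trans hk1
    _ = ‖ξ‖ ^ 2 := by ring

lemma card_filter_abs_sub_le {ι : Type*} [Fintype ι] {c : ι → ℤ} (hc : Function.Injective c)
    (m : ℤ) : (Finset.univ.filter fun j => |m - c j| ≤ 2).card ≤ 5 := by
  have h : (Finset.univ.filter fun j => |m - c j| ≤ 2).card ≤ (Finset.Icc (m - 2) (m + 2)).card := by
    refine Finset.card_le_card_of_injOn c (fun j hj => ?_) hc.injOn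
    have := (Finset.mem_filter.1 hj).2
    rw [abs_le] at this
    exact Finset.mem_Icc.2 ⟨by omega, by omega⟩
  refine h.trans ?_
  rw [Int.card_Icc]; omega

lemma sum_band_le {ι : Type*} [Fintype ι] {c : ι → ℤ} (hc : Function.Injective c)
    (a b : ι → ℝ) :
    ∑ p ∈ (Finset.univ : Finset (ι × ι)).filter (fun p => |c p.1 - c p.2| ≤ 2), a p.1 * b p.2
      ≤ 5 * (√(∑ i, a i ^ 2) * √(∑ i, b i ^ 2)) := by
  refine (Real.sum_mul_le_sqrt_mul_sqrt _ _ _).trans ?_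
  have hA : ∑ p ∈ (Finset.univ : Finset (ι × ι)).filter (fun p => |c p.1 - c p.2| ≤ 2),
      a p.1 ^ 2 ≤ 5 * ∑ i, a i ^ 2 := by
    rw [Finset.sum_filter, ← Finset.univ_product_univ, Finset.sum_product, Finset.mul_sum]
    refine Finset.sum_le_sum fun i _ => ?_
    simp only
    rw [← Finset.sum_filter, Finset.sum_const, nsmul_eq_mul]
    gcongr
    exact_mod_cast card_filter_abs_sub_le hc (c i)
  have hB : ∑ p ∈ (Finset.univ : Finset (ι × ι)).filter (fun p => |c p.1 - c p.2| ≤ 2),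
      b p.2 ^ 2 ≤ 5 * ∑ i, b i ^ 2 := by
    rw [Finset.sum_filter, ← Finset.univ_product_univ, Finset.sum_product_right, Finset.mul_sum]
    refine Finset.sum_le_sum fun i _ => ?_
    simp only
    rw [← Finset.sum_filter, Finset.sum_const, nsmul_eq_mul]
    gcongr
    simp_rw [abs_sub_comm _ (c i)]
    exact_mod_cast card_filter_abs_sub_le hc (c i)
  calc _ ≤ √(5 * ∑ i, a i ^ 2) * √(5 * ∑ i, b i ^ 2) := by gcongr
    _ = (√5 * √5) * (√(∑ i, a i ^ 2) * √(∑ i, b i ^ 2)) := by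
      rw [Real.sqrt_mul (by norm_num), Real.sqrt_mul (by norm_num)]; ring
    _ = _ := by rw [Real.mul_self_sqrt (by norm_num)]

lemma norm_band_le {ι : Type*} [Fintype ι] {c : ι → ℤ} (hc : Function.Injective c)
    (h : ι → C(Z, ℝ)) (h0 : ∀ i x, 0 ≤ h i x) (h1 : ∀ x, ∑ i, h i x ≤ 1)
    (T : H →L[ℂ] H) (w : ι → ι → ℂ) {ε : ℝ} (hε : 0 ≤ ε)
    (hw : ∀ i j, |c i - c j| ≤ 2 → ‖w i j‖ ≤ ε)
    (hT : ∀ i j, ¬ |c i - c j| ≤ 2 →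
      ρ (complexify (h i)) * T * ρ (complexify (h j)) = 0) :
    ‖∑ p : ι × ι, w p.1 p.2 • (ρ (complexify (h p.1)) * T * ρ (complexify (h p.2)))‖
      ≤ 5 * ε * ‖T‖ := by
  set A := ∑ p : ι × ι, w p.1 p.2 • (ρ (complexify (h p.1)) * T * ρ (complexify (h p.2))) with hA
  have hA' : A = ∑ p ∈ (Finset.univ : Finset (ι × ι)).filter (fun p => |c p.1 - c p.2| ≤ 2),
      w p.1 p.2 • (ρ (complexify (h p.1)) * T * ρ (complexify (h p.2))) := by
    rw [hA, Finset.sum_filter_of_ne]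
    intro p _ hp
    by_contra hcon
    exact hp (by rw [hT _ _ hcon, smul_zero])
  have hform : ∀ η ξ : H, ‖inner ℂ η (A ξ)‖ ≤ 5 * ε * ‖T‖ * (‖η‖ * ‖ξ‖) := by
    intro η ξ
    have hterm : ∀ p ∈ (Finset.univ : Finset (ι × ι)).filter (fun p => |c p.1 - c p.2| ≤ 2),
        ‖inner ℂ η ((w p.1 p.2 • (ρ (complexify (h p.1)) * T * ρ (complexify (h p.2)))) ξ)‖
        ≤ ε * ‖T‖ * (‖ρ (complexify (h p.1)) η‖ * ‖ρ (complexify (h p.2)) ξ‖) := by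
      intro p hp
      have hstar : star (complexify (h p.1)) = complexify (h p.1) := by ext x; simp
      have hadj : ContinuousLinearMap.adjoint (ρ (complexify (h p.1)))
          = ρ (complexify (h p.1)) := by
        rw [← ContinuousLinearMap.star_eq_adjoint, ← map_star, hstar]
      rw [smul_apply, inner_smul_right, norm_mul,
        mul_apply_eq_comp, mul_apply_eq_comp,
        ← ContinuousLinearMap.adjoint_inner_left, hadj]
      calc _ ≤ ε * (‖ρ (complexify (h p.1)) η‖ * (‖T‖ * ‖ρ (complexify (h p.2)) ξ‖)) := by
            gcongr
            · exact hw _ _ (Finset.mem_filter.1 hp).2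
            · refine (norm_inner_le_norm _ _).trans ?_
              gcongr
              exact T.le_opNorm _
        _ = _ := by ring
    rw [hA', _root_.sum_apply, inner_sum]
    refine (norm_sum_le_of_le _ hterm).trans ?_
    rw [← Finset.mul_sum]
    calc _ ≤ ε * ‖T‖ * (5 * (√(∑ i, ‖ρ (complexify (h i)) η‖ ^ 2)
            * √(∑ i, ‖ρ (complexify (h i)) ξ‖ ^ 2))) := by
          gcongr
          exact sum_band_le hc (fun i => ‖ρ (complexify (h i)) η‖)
            fun i => ‖ρ (complexify (h i)) ξ‖
      _ ≤ ε * ‖T‖ * (5 * (√(‖η‖ ^ 2) * √(‖ξ‖ ^ 2))) := by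
          gcongr <;> exact sum_norm_sq_rep_le ρ h h0 h1 _
      _ = _ := by
          rw [Real.sqrt_sq (norm_nonneg _), Real.sqrt_sq (norm_nonneg _)]; ring
  refine ContinuousLinearMap.opNorm_le_bound _ (by positivity) fun ξ => ?_
  have h2 := hform (A ξ) ξ
  rw [inner_self_eq_norm_sq_to_K, norm_pow, RCLike.norm_ofReal, abs_norm] at h2
  rcases (norm_nonneg (A ξ)).eq_or_lt with h3 | h3
  · rw [← h3]; positivity
  · refine le_of_mul_le_mul_left ?_ h3
    linarith

lemma eventually_norm_commutator_le [T2Space Z] {α : Type*} {l : Filter α} {S : α → H →L[ℂ] H}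
    (hS : ∀ g f : C(Z, ℂ), Disjoint (tsupport ⇑g) (tsupport ⇑f) →
      ∀ᶠ t in l, ρ g * S t * ρ f = 0)
    (f : C(Z, ℝ)) (n : ℕ) (hn : 0 < n) :
    ∀ᶠ t in l, ‖ρ (complexify f) * S t - S t * ρ (complexify f)‖ ≤ 12 / n * ‖S t‖ := by
  have hn' : (0 : ℝ) < n := by exact_mod_cast hn
  obtain ⟨M, hM⟩ : ∃ M : ℤ, n * ‖f‖ ≤ M := ⟨_, Int.le_ceil _⟩
  have hfM : ∀ x, |n * f x| ≤ M := fun x => by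
    rw [abs_mul, abs_of_pos hn']
    exact (mul_le_mul_of_nonneg_left (f.norm_coe_le_norm x) hn'.le).trans hM
  let c : Finset.Icc (-M) M → ℤ := Subtype.val
  let U : Finset.Icc (-M) M → Set Z := fun i => {x | |n * f x - c i| < 1}
  have hUo : ∀ i, IsOpen (U i) := fun i =>
    isOpen_lt (by fun_prop) continuous_const
  have hU : (Set.univ : Set Z) ⊆ ⋃ i, U i := by
    intro x _
    have h1 := abs_le.1 (hfM x)
    have hmem : ⌊n * f x⌋ ∈ Finset.Icc (-M) M := by
      rw [Finset.mem_Icc]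
      refine ⟨Int.le_floor.2 (by push_cast; exact h1.1), ?_⟩
      exact_mod_cast (Int.floor_le (n * f x)).trans h1.2
    refine Set.mem_iUnion.2 ⟨⟨_, hmem⟩, ?_⟩
    have h2 := Int.floor_le (n * f x)
    have h3 := Int.lt_floor_add_one (n * f x)
    change |n * f x - (⌊n * f x⌋ : ℝ)| < 1
    rw [abs_lt]; constructor <;> linarith
  obtain ⟨h, hhU, h0, h1, h1'⟩ := exists_finite_partition isClosed_univ U hUo hU
  have hdisj : ∀ i j, ¬ |c i - c j| ≤ 2 →
      Disjoint (tsupport ⇑(complexify (h i))) (tsupport ⇑(complexify (h j))) := by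
    intro i j hij
    rw [tsupport_complexify, tsupport_complexify, Set.disjoint_left]
    intro x hx hx'
    have hi := abs_lt.1 (show |n * f x - c i| < 1 from hhU i hx)
    have hj := abs_lt.1 (show |n * f x - c j| < 1 from hhU j hx')
    refine hij ?_
    have : |(c i : ℝ) - c j| ≤ 2 := abs_le.2 ⟨by linarith, by linarith⟩
    exact_mod_cast this
  have hev : ∀ᶠ t in l, ∀ i j, ¬ |c i - c j| ≤ 2 →
      ρ (complexify (h i)) * S t * ρ (complexify (h j)) = 0 := by
    simp only [Filter.eventually_all]
    exact fun i j hij => hS _ _ (hdisj i j hij)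
  filter_upwards [hev] with t ht
  set k : C(Z, ℂ) := ∑ i, ((c i : ℂ) / n) • complexify (h i) with hk
  have hsum : ∑ i, complexify (h i) = 1 := by
    ext x
    have : ∑ i, (h i x : ℂ) = 1 := by exact_mod_cast h1 x trivial
    simpa [ContinuousMap.sum_apply] using this
  have hfk : ‖complexify f - k‖ ≤ 1 / n := by
    rw [ContinuousMap.norm_le _ (by positivity)]
    intro x
    have hx : (complexify f - k) x = ((∑ i, h i x * (f x - c i / n) : ℝ) : ℂ) := by
      have h2 : ∑ i, h i x = 1 := h1 x trivial
      have h3 : ∑ i, h i x * (f x - c i / n) = f x - ∑ i, c i / n * h i x := by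
        simp_rw [mul_sub, Finset.sum_sub_distrib, ← Finset.sum_mul, h2, one_mul, mul_comm]
      rw [h3]
      simp [hk, ContinuousMap.sum_apply]
    rw [hx, Complex.norm_real]
    calc ‖∑ i, h i x * (f x - c i / n)‖ ≤ ∑ i, h i x * (1 / n) := by
          refine norm_sum_le_of_le _ fun i _ => ?_
          rw [norm_mul, Real.norm_of_nonneg (h0 i x)]
          rcases eq_or_ne (h i x) 0 with hz | hz
          · simp [hz]
          · refine mul_le_mul_of_nonneg_left ?_ (h0 i x)
            have := hhU i (subset_tsupport _ hz)
            have h4 : |n * f x - c i| < 1 := this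
            have h5 : f x - c i / n = (n * f x - c i) / n := by field_simp
            rw [h5, Real.norm_eq_abs, abs_div, abs_of_pos hn']
            gcongr
      _ = 1 / n := by rw [← Finset.sum_mul, h1 x trivial, one_mul]
  have hband : ρ k * S t - S t * ρ k = ∑ p : Finset.Icc (-M) M × Finset.Icc (-M) M,
      (((c p.1 : ℂ) - c p.2) / n) •
        (ρ (complexify (h p.1)) * S t * ρ (complexify (h p.2))) := by
    have hρ1 : ∑ i, ρ (complexify (h i)) = 1 := by rw [← map_sum, hsum, map_one]
    have hρk : ρ k = ∑ i, ((c i : ℂ) / n) • ρ (complexify (h i)) := by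
      simp [hk, map_sum, map_smul]
    have e1 : ρ k * S t = ∑ i, ∑ j, ((c i : ℂ) / n) •
        (ρ (complexify (h i)) * S t * ρ (complexify (h j))) := by
      conv_lhs => rw [← mul_one (ρ k * S t), ← hρ1, hρk]
      simp_rw [Finset.sum_mul, Finset.mul_sum, smul_mul_assoc]
    have e2 : S t * ρ k = ∑ i, ∑ j, ((c j : ℂ) / n) •
        (ρ (complexify (h i)) * S t * ρ (complexify (h j))) := by
      conv_lhs => rw [← one_mul (S t * ρ k), ← hρ1, hρk]
      simp_rw [Finset.sum_mul, Finset.mul_sum, mul_smul_comm, mul_assoc]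
    rw [e1, e2, ← Finset.sum_sub_distrib, ← Finset.univ_product_univ, Finset.sum_product]
    simp_rw [← Finset.sum_sub_distrib, ← sub_smul, sub_div]
  have hbd : ‖ρ k * S t - S t * ρ k‖ ≤ 5 * (2 / n) * ‖S t‖ := by
    rw [hband]
    refine norm_band_le ρ Subtype.val_injective h h0 h1' (S t)
      (fun i j => ((c i : ℂ) - c j) / n) (by positivity) (fun i j hij => ?_) ht
    have h6 : ‖(c i : ℂ) - c j‖ ≤ 2 := by
      rw [← Int.cast_sub, Complex.norm_intCast]
      exact_mod_cast hij
    rw [norm_div, Complex.norm_natCast]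
    gcongr
  have hdec : ρ (complexify f) * S t - S t * ρ (complexify f)
      = ρ (complexify f - k) * S t - S t * ρ (complexify f - k) + (ρ k * S t - S t * ρ k) := by
    rw [map_sub, sub_mul, mul_sub]; abel
  have hsmall : ‖ρ (complexify f - k)‖ ≤ 1 / n := (norm_rep_le ρ _).trans hfk
  rw [hdec]
  calc _ ≤ (1 / n * ‖S t‖ + ‖S t‖ * (1 / n)) + 5 * (2 / n) * ‖S t‖ := by
        refine (norm_add_le _ _).trans (add_le_add ((norm_sub_le _ _).trans (add_le_add ?_ ?_)) hbd)
        · exact (norm_mul_le _ _).trans (by gcongr)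
        · exact (norm_mul_le _ _).trans (by gcongr)
    _ = 12 / n * ‖S t‖ := by ring

/-- If a bounded family is eventually annihilated by compressions to disjoint supports, then
it asymptotically commutes with the representation. -/
lemma tendsto_norm_commutator [T2Space Z] {α : Type*} {l : Filter α} {S : α → H →L[ℂ] H}
    (hS : ∀ g f : C(Z, ℂ), Disjoint (tsupport ⇑g) (tsupport ⇑f) →
      ∀ᶠ t in l, ρ g * S t * ρ f = 0)
    {C : ℝ} (hC : ∀ᶠ t in l, ‖S t‖ ≤ C) (f : C(Z, ℂ)) :
    Tendsto (fun t => ρ f * S t - S t * ρ f) l (𝓝 0) := by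
  have hreal : ∀ f : C(Z, ℝ),
      Tendsto (fun t => ρ (complexify f) * S t - S t * ρ (complexify f)) l (𝓝 0) := by
    intro f
    rw [tendsto_zero_iff_norm_tendsto_zero, Metric.tendsto_nhds]
    intro ε hε
    have hlim : Tendsto (fun n : ℕ => 12 / (n : ℝ) * C) atTop (𝓝 0) := by
      simpa using (tendsto_const_div_atTop_nhds_zero_nat (12 : ℝ)).mul_const C
    obtain ⟨n, hn, hn0⟩ :=
      ((hlim.eventually (gt_mem_nhds hε)).and (eventually_gt_atTop 0)).exists
    filter_upwards [hC, eventually_norm_commutator_le ρ hS f n hn0] with t h1 h2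
    rw [dist_zero_right, norm_norm]
    refine (h2.trans ?_).trans_lt hn
    gcongr
  let u : C(Z, ℝ) := ⟨fun x => (f x).re, Complex.continuous_re.comp f.continuous⟩
  let v : C(Z, ℝ) := ⟨fun x => (f x).im, Complex.continuous_im.comp f.continuous⟩
  have hf : f = complexify u + Complex.I • complexify v := by
    ext x
    simp only [u, v, ContinuousMap.add_apply, ContinuousMap.smul_apply, complexify_apply,
      ContinuousMap.coe_mk, smul_eq_mul]
    rw [mul_comm, Complex.re_add_im]
  have h := (hreal u).add ((hreal v).const_smul Complex.I)
  rw [smul_zero, add_zero] at h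
  refine h.congr fun t => ?_
  conv_rhs => rw [hf]
  rw [map_add, map_smul, add_mul, mul_add, smul_sub, smul_mul_assoc, mul_smul_comm]
  abel


/-- The metric space structure on `Z` given by a compatible metric. -/
abbrev CompatMetric.toMetricSpace {Z : Type*} [TopologicalSpace Z] (D : CompatMetric Z) :
    MetricSpace Z :=
  MetricSpace.ofDistTopology D.d D.refl D.symm (fun x y z => D.triangle x y z) D.compat
    fun _ _ h => D.eq_of_d h

lemma CompatMetric.continuous {Z : Type*} [TopologicalSpace Z] (D : CompatMetric Z) :
    Continuous fun p : Z × Z => D.d p.1 p.2 := by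
  let := D.toMetricSpace
  exact continuous_dist (α := Z)

lemma CompatMetric.exists_finite_cover (D : CompatMetric Z) {ε : ℝ} (hε : 0 < ε) :
    ∃ s : Finset Z, (Set.univ : Set Z) ⊆ ⋃ c : s, {x | D.d x c < ε} := by
  let := D.toMetricSpace
  obtain ⟨t, -, ht, hcov⟩ := (isCompact_univ (X := Z)).finite_cover_balls hε
  refine ⟨ht.toFinset, fun x hx => ?_⟩
  obtain ⟨c, hc, hxc⟩ := Set.mem_iUnion₂.1 (hcov hx)
  exact Set.mem_iUnion.2 ⟨⟨c, ht.mem_toFinset.2 hc⟩, hxc⟩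

/-- A neighbourhood of the diagonal of a compact space contains a uniform one. -/
lemma CompatMetric.exists_lt_mem_of_diagonal (D : CompatMetric Z) {U : Set (Z × Z)} (hU : IsOpen U)
    (hdiag : ∀ z, (z, z) ∈ U) : ∃ ε > 0, ∀ p : Z × Z, D.d p.1 p.2 < ε → p ∈ U := by
  let := D.toMetricSpace
  have hcov : IsCompact (Uᶜ : Set (Z × Z)) := hU.isClosed_compl.isCompact
  rcases (Uᶜ : Set (Z × Z)).eq_empty_or_nonempty with h | h
  · exact ⟨1, one_pos, fun p _ => by
      by_contra hp
      exact (Set.mem_empty_iff_false p).1 (h ▸ hp)⟩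
  · obtain ⟨q, hq, hmin⟩ := hcov.exists_isMinOn h D.continuous.continuousOn
    refine ⟨D.d q.1 q.2, ?_, fun p hp => ?_⟩
    · refine lt_of_le_of_ne (dist_nonneg (x := q.1) (y := q.2)) fun h0 => hq ?_
      have : q = (q.1, q.1) := Prod.ext rfl (D.eq_of_d h0.symm).symm
      rw [this]
      exact hdiag _
    · by_contra hpU
      exact absurd hp (not_lt.2 (hmin hpU))

/-- At every scale there is a cutting-down operation producing controlled operators, which is
asymptotically trivial on families that asymptotically commute with the representation. -/
lemma exists_cutdown [T2Space Z] (D : CompatMetric Z) {ε : ℝ} (hε : 0 < ε) :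
    ∃ Φ : (H →L[ℂ] H) → (H →L[ℂ] H), Continuous Φ ∧
      (∀ A : H →L[ℂ] H, IsCompactOperator ⇑A → IsCompactOperator ⇑(Φ A)) ∧
      (∀ A, Controlled ρ D ε (Φ A)) ∧
      ∀ {α : Type} {l : Filter α} {S : α → H →L[ℂ] H},
        (∀ f, Tendsto (fun t => ρ f * S t - S t * ρ f) l (𝓝 0)) →
        Tendsto (fun t => Φ (S t) - S t) l (𝓝 0) := by
  classical
  obtain ⟨s, hs⟩ := D.exists_finite_cover (show 0 < ε / 4 by positivity)
  obtain ⟨φ, hφU, -, hφ1, -⟩ := exists_finite_partition (isClosed_univ (X := Z))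
    (fun c : s => {x | D.d x c < ε / 4})
    (fun c => isOpen_lt (D.continuous.comp (by fun_prop : Continuous fun x => (x, (c : Z))))
      continuous_const) hs
  let ψ : s → C(Z, ℂ) := fun i => complexify (φ i)
  have hψU : ∀ i x, ψ i x ≠ 0 → D.d x i < ε / 4 := fun i x hx =>
    hφU i (subset_tsupport _ (by simpa [ψ] using hx))
  have hψ1 : ∑ i, ρ (ψ i) = 1 := by
    have : ∑ i, ψ i = 1 := by
      ext x
      have : ∑ i, (φ i x : ℂ) = 1 := by exact_mod_cast hφ1 x trivial
      simpa [ContinuousMap.sum_apply, ψ] using this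
    rw [← map_sum, this, map_one]
  have hfull : ∀ A : H →L[ℂ] H, A = ∑ p : s × s, ρ (ψ p.1) * A * ρ (ψ p.2) := by
    intro A
    rw [← Finset.univ_product_univ, Finset.sum_product]
    conv_lhs => rw [← one_mul A, ← mul_one (1 * A), ← hψ1]
    simp_rw [Finset.sum_mul, Finset.mul_sum]
  refine ⟨fun A => ∑ p ∈ (Finset.univ : Finset (s × s)).filter
    (fun p => ψ p.1 * ψ p.2 ≠ 0), ρ (ψ p.1) * A * ρ (ψ p.2), by fun_prop, ?_, ?_, ?_⟩
  · intro A hA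
    refine Finset.sum_induction _ (fun B : H →L[ℂ] H => IsCompactOperator ⇑B)
      (fun a b ha hb => ha.add hb) isCompactOperator_zero fun p _ => ?_
    exact (hA.clm_comp (ρ (ψ p.1))).comp_clm (ρ (ψ p.2))
  · intro A g f hgf
    rw [Finset.mul_sum, Finset.sum_mul]
    refine Finset.sum_eq_zero fun p hp => ?_
    have hre : ρ g * (ρ (ψ p.1) * A * ρ (ψ p.2)) * ρ f = ρ (g * ψ p.1) * A * ρ (ψ p.2 * f) := by
      simp only [map_mul, mul_assoc]
    rw [hre]
    by_cases h1 : g * ψ p.1 = 0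
    · rw [h1, map_zero, zero_mul, zero_mul]
    by_cases h2 : ψ p.2 * f = 0
    · rw [h2, map_zero, mul_zero]
    obtain ⟨y, hy⟩ := DFunLike.ne_iff.1 h1
    obtain ⟨x, hx⟩ := DFunLike.ne_iff.1 h2
    obtain ⟨z, hz⟩ := DFunLike.ne_iff.1 (Finset.mem_filter.1 hp).2
    simp only [ContinuousMap.mul_apply, ContinuousMap.zero_apply, mul_ne_zero_iff] at hx hy hz
    have hlt := hgf y (subset_tsupport _ hy.1) x (subset_tsupport _ hx.2)
    have d1 := hψU _ _ hy.2
    have d2 := hψU _ _ hz.1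
    have d3 := hψU _ _ hz.2
    have d4 := hψU _ _ hx.1
    have t1 := D.triangle y p.1 x
    have t2 := D.triangle p.1 z x
    have t3 := D.triangle z p.2 x
    rw [D.symm] at d2 d4
    linarith
  · intro α l S hS
    have hdiff : ∀ A : H →L[ℂ] H,
        (∑ p ∈ (Finset.univ : Finset (s × s)).filter (fun p => ψ p.1 * ψ p.2 ≠ 0),
          ρ (ψ p.1) * A * ρ (ψ p.2)) - A =
        -∑ p ∈ (Finset.univ : Finset (s × s)).filter (fun p => ¬ ψ p.1 * ψ p.2 ≠ 0),
          (ρ (ψ p.1) * A - A * ρ (ψ p.1)) * ρ (ψ p.2) := by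
      intro A
      have h2 : ∑ p ∈ (Finset.univ : Finset (s × s)).filter (fun p => ¬ ψ p.1 * ψ p.2 ≠ 0),
          (ρ (ψ p.1) * A - A * ρ (ψ p.1)) * ρ (ψ p.2) =
          ∑ p ∈ (Finset.univ : Finset (s × s)).filter (fun p => ¬ ψ p.1 * ψ p.2 ≠ 0),
          ρ (ψ p.1) * A * ρ (ψ p.2) := by
        refine Finset.sum_congr rfl fun p hp => ?_
        have h0 := not_not.1 (Finset.mem_filter.1 hp).2
        rw [sub_mul, mul_assoc A, ← map_mul, h0, map_zero, mul_zero, sub_zero]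
      rw [h2]
      conv_lhs => rhs; rw [hfull A]
      rw [← Finset.sum_filter_add_sum_filter_not Finset.univ
        (fun p : s × s => ψ p.1 * ψ p.2 ≠ 0) (fun p => ρ (ψ p.1) * A * ρ (ψ p.2))]
      abel
    simp_rw [hdiff]
    have hzero : ∀ p : s × s,
        Tendsto (fun t => (ρ (ψ p.1) * S t - S t * ρ (ψ p.1)) * ρ (ψ p.2)) l (𝓝 0) := fun p => by
      simpa using (hS (ψ p.1)).mul_const (ρ (ψ p.2))
    have h := (tendsto_finsetSum ((Finset.univ : Finset (s × s)).filter
      (fun p => ¬ ψ p.1 * ψ p.2 ≠ 0)) fun p _ => hzero p).neg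
    rwa [Finset.sum_const_zero, neg_zero] at h

/-- A continuous asymptotically commuting family is asymptotic to a continuous family whose
members are controlled at scales tending to `0`. -/
lemma exists_controlled_approx [T2Space Z] (D : CompatMetric Z) {T : ℝ → H →L[ℂ] H}
    (hT : Continuous T) (hcomm : ∀ f, Tendsto (fun t => ρ f * T t - T t * ρ f) atTop (𝓝 0)) :
    ∃ S : ℝ → H →L[ℂ] H, Continuous S ∧
      (∀ t, IsCompactOperator ⇑(T t) → IsCompactOperator ⇑(S t)) ∧
      (∀ t, ‖S t - T t‖ ≤ 1) ∧ Tendsto (fun t => S t - T t) atTop (𝓝 0) ∧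
      ∀ ε > 0, ∀ᶠ t in atTop, Controlled ρ D ε (S t) := by
  have hpos : ∀ m : ℕ, (0 : ℝ) < 1 / ((m : ℝ) + 1) := fun m => Nat.one_div_pos_of_nat
  choose Φ hΦc hΦK hΦD hΦT using fun m : ℕ => exists_cutdown ρ D (hpos m)
  have hthr : ∀ m : ℕ, ∃ τ : ℝ, (m : ℝ) ≤ τ ∧
      ∀ t ≥ τ, ‖Φ m (T t) - T t‖ ≤ 1 / ((m : ℝ) + 1) := by
    intro m
    have h := (hΦT m hcomm).norm.eventually_le_const
      (u := 1 / ((m : ℝ) + 1)) (by simpa using hpos m)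
    obtain ⟨τ, hτ⟩ := eventually_atTop.1 h
    exact ⟨max m τ, le_max_left _ _, fun t ht => hτ t ((le_max_right _ _).trans ht)⟩
  choose τ hτm hτ using hthr
  let K : ℝ → Set (H →L[ℂ] H) := fun x =>
    {A | (IsCompactOperator ⇑(T x) → IsCompactOperator ⇑A) ∧ ‖A - T x‖ ≤ 1 ∧
      ∀ m, τ m ≤ x - 2 → Controlled ρ D (1 / ((m : ℝ) + 1)) A ∧
        ‖A - T x‖ ≤ 1 / ((m : ℝ) + 1)}
  have hball : ∀ (x r : ℝ) (A B : H →L[ℂ] H), ‖A - T x‖ ≤ r → ‖B - T x‖ ≤ r →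
      ∀ a b : ℝ, 0 ≤ a → 0 ≤ b → a + b = 1 → ‖a • A + b • B - T x‖ ≤ r := by
    intro x r A B hA hB a b ha hb hab
    rw [← mem_closedBall_iff_norm] at hA hB ⊢
    exact convex_closedBall _ _ hA hB ha hb hab
  have hconv : ∀ x, Convex ℝ (K x) := by
    intro x A hA B hB a b ha hb hab
    refine ⟨fun hx => ((hA.1 hx).smul a).add ((hB.1 hx).smul b),
      hball x 1 A B hA.2.1 hB.2.1 a b ha hb hab, fun m hm => ⟨?_, ?_⟩⟩
    · exact (hA.2.2 m hm).1.combo (hB.2.2 m hm).1 a b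
    · exact hball x _ A B (hA.2.2 m hm).2 (hB.2.2 m hm).2 a b ha hb hab
  have hloc : ∀ x : ℝ, ∃ U ∈ 𝓝 x, ∃ g : ℝ → H →L[ℂ] H, ContinuousOn g U ∧ ∀ y ∈ U, g y ∈ K y := by
    intro x
    refine ⟨Set.Ioo (x - 1) (x + 1), Ioo_mem_nhds (by linarith) (by linarith), ?_⟩
    have hfin : {m : ℕ | τ m ≤ x - 1}.Finite := by
      refine (Set.finite_le_nat ⌈x - 1⌉₊).subset fun m hm => ?_
      exact_mod_cast ((hτm m).trans hm).trans (Nat.le_ceil _)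
    rcases Set.eq_empty_or_nonempty {m : ℕ | τ m ≤ x - 1} with he | hne
    · refine ⟨T, hT.continuousOn, fun y hy => ⟨id, by simp, fun m hm => ?_⟩⟩
      have : m ∈ {m : ℕ | τ m ≤ x - 1} := by
        have := hy.2; simp only [Set.mem_ofPred_eq]; linarith
      rw [he] at this
      exact this.elim
    · obtain ⟨M, hM, hMmax⟩ := hfin.exists_maximalFor id _ hne
      refine ⟨fun y => Φ M (T y), ((hΦc M).comp hT).continuousOn, fun y hy => ?_⟩
      have hMy : τ M ≤ y := (show τ M ≤ x - 1 from hM).trans hy.1.le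
      have hle : ∀ m : ℕ, m ≤ M → 1 / ((M : ℝ) + 1) ≤ 1 / ((m : ℝ) + 1) :=
        fun m hm => Nat.one_div_le_one_div hm
      refine ⟨hΦK M _, (hτ M y hMy).trans ((hle 0 M.zero_le).trans (by simp)), fun m hm => ?_⟩
      have hmM : m ≤ M := by
        have hm' : m ∈ {m : ℕ | τ m ≤ x - 1} := by
          have := hy.2; simp only [Set.mem_ofPred_eq]; linarith
        exact (le_total m M).elim id fun h => hMmax hm' h
      exact ⟨(hΦD M _).mono (hle m hmM), (hτ M y hMy).trans (hle m hmM)⟩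
  obtain ⟨S, hS⟩ := exists_continuous_forall_mem_convex_of_local hconv hloc
  refine ⟨S, S.continuous, fun t => (hS t).1, fun t => (hS t).2.1, ?_, fun ε hε => ?_⟩
  · rw [tendsto_zero_iff_norm_tendsto_zero, Metric.tendsto_nhds]
    intro ε hε
    obtain ⟨m, hm⟩ := exists_nat_one_div_lt hε
    filter_upwards [eventually_ge_atTop (τ m + 2)] with t ht
    rw [dist_zero_right, norm_norm]
    exact ((hS t).2.2 m (by linarith)).2.trans_lt hm
  · obtain ⟨m, hm⟩ := exists_nat_one_div_lt hε
    filter_upwards [eventually_ge_atTop (τ m + 2)] with t ht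
    exact ((hS t).2.2 m (by linarith)).1.mono hm.le

end CompactHausdorff

section OnePointRep

variable {π : C₀(X, ℂ) → H →L[ℂ] H}

/-- The unital representation of `C(X⁺, ℂ)` extending a representation of `C₀(X, ℂ)`. -/
def onePointRep (hπ : IsStarRep π) : C(OnePoint X, ℂ) →⋆ₐ[ℂ] (H →L[ℂ] H) where
  toFun := onePointAct π
  map_one' := by
    have h : onePointRestrict (1 : C(OnePoint X, ℂ)) = (0 : ℂ) • (0 : C₀(X, ℂ)) := by
      ext x; simp [onePointRestrict]
    rw [onePointAct, h, hπ.map_smul]; simp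
  map_mul' f g := by
    have h : onePointRestrict (f * g) = onePointRestrict f * onePointRestrict g +
        (f OnePoint.infty • onePointRestrict g + g OnePoint.infty • onePointRestrict f) := by
      ext x; simp [onePointRestrict]; ring
    simp only [onePointAct, h, hπ.map_add, hπ.map_smul, hπ.map_mul, ← ContinuousLinearMap.mul_def,
      add_mul, mul_add, smul_mul_assoc, mul_smul_comm, one_mul, mul_one,
      ContinuousMap.mul_apply, smul_add]
    rw [smul_smul, mul_comm (g OnePoint.infty)]
    abel
  map_zero' := by
    have h : onePointRestrict (0 : C(OnePoint X, ℂ)) = (0 : ℂ) • (0 : C₀(X, ℂ)) := by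
      ext x; simp [onePointRestrict]
    rw [onePointAct, h, hπ.map_smul]; simp
  map_add' f g := by
    have h : onePointRestrict (f + g) = onePointRestrict f + onePointRestrict g := by
      ext x; simp [onePointRestrict]; ring
    simp only [onePointAct, h, hπ.map_add, ContinuousMap.add_apply, add_smul]
    abel
  commutes' a := by
    have h : onePointRestrict (algebraMap ℂ C(OnePoint X, ℂ) a) = (0 : ℂ) • (0 : C₀(X, ℂ)) := by
      ext x; simp [onePointRestrict]
    rw [onePointAct, h, hπ.map_smul, Algebra.algebraMap_eq_smul_one (A := H →L[ℂ] H)]; simp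
  map_star' f := by
    have h : onePointRestrict (star f) = star (onePointRestrict f) := by
      ext x; simp [onePointRestrict]
    rw [onePointAct, onePointAct, h, ← hπ.map_star, star_add, star_smul, star_one,
      ContinuousLinearMap.star_eq_adjoint, ContinuousMap.star_apply]

lemma onePointRep_apply (hπ : IsStarRep π) (f : C(OnePoint X, ℂ)) :
    onePointRep hπ f = onePointAct π f := rfl

lemma commutator_onePointRep (hπ : IsStarRep π) (f : C(OnePoint X, ℂ)) (T : H →L[ℂ] H) :
    onePointRep hπ f * T - T * onePointRep hπ f =
      (π (onePointRestrict f)).comp T - T.comp (π (onePointRestrict f)) := by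
  rw [onePointRep_apply, onePointAct, add_mul, mul_add, smul_mul_assoc, mul_smul_comm, one_mul,
    mul_one, ContinuousLinearMap.mul_def, ContinuousLinearMap.mul_def]
  abel

lemma exists_onePointRestrict_eq [T2Space X] (φ : C₀(X, ℂ)) :
    ∃ f : C(OnePoint X, ℂ), onePointRestrict f = φ := by
  refine ⟨OnePoint.continuousMapMk φ.toContinuousMap 0 ?_, ?_⟩
  · rw [coclosedCompact_eq_cocompact]; exact φ.zero_at_infty'
  · ext x
    change φ x - 0 = φ x
    simp

lemma commDecay_iff [T2Space X] (hπ : IsStarRep π) (T : ℝ → H →L[ℂ] H) :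
    CommDecay π T ↔ ∀ f, Tendsto (fun t => onePointRep hπ f * T t - T t * onePointRep hπ f)
      atTop (𝓝 0) := by
  simp only [commutator_onePointRep]
  refine ⟨fun h f => tendsto_zero_iff_norm_tendsto_zero.2 (h _), fun h φ => ?_⟩
  obtain ⟨f, rfl⟩ := exists_onePointRestrict_eq φ
  exact tendsto_zero_iff_norm_tendsto_zero.1 (h f)

lemma mul_mul_eq_zero_of_disjoint_opSupportPlus [T2Space X] [LocallyCompactSpace X]
    (hπ : IsStarRep π) {T : H →L[ℂ] H} {g f : C(OnePoint X, ℂ)}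
    (h : ∀ y ∈ tsupport ⇑g, ∀ x ∈ tsupport ⇑f, (y, x) ∉ opSupportPlus π T) :
    onePointRep hπ g * T * onePointRep hπ f = 0 := by
  refine bilin_eq_zero_of_locally (compression (onePointRep hπ) T) g f fun y hy x hx => ?_
  have := h y hy x hx
  simp only [opSupportPlus, Set.mem_ofPred_eq, not_forall, not_exists, not_and, not_not] at this
  obtain ⟨U, V, hU, hV, hxU, hyV, hUV⟩ := this
  refine ⟨U, V, hU, hV, hxU, hyV, fun f' g' hf' hg' => ?_⟩
  rw [compression_apply, mul_assoc]
  exact hUV f' g' hf' hg'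

lemma dist_le_of_mem_opSupportPlus (hπ : IsStarRep π) {D : CompatMetric (OnePoint X)} {ε : ℝ}
    {T : H →L[ℂ] H} (hT : Controlled (onePointRep hπ) D ε T) {p : OnePoint X × OnePoint X}
    (hp : p ∈ opSupportPlus π T) : D.d p.1 p.2 ≤ ε := by
  by_contra! hlt
  have hopen : IsOpen {q : OnePoint X × OnePoint X | ε < D.d q.1 q.2} :=
    isOpen_lt continuous_const D.continuous
  obtain ⟨V, U, hV, hU, hpV, hpU, hVU⟩ := isOpen_prod_iff.1 hopen p.1 p.2 hlt
  obtain ⟨f, g, hf, hg, hne⟩ := hp U V hU hV hpU hpV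
  refine hne ?_
  have := hT g f fun y hy x hx => hVU (Set.mk_mem_prod (hg hy) (hf hx))
  rwa [mul_assoc] at this

lemma propDecayPlus_iff_smallSuppPlus {K : Type*} [NormedAddCommGroup K] [InnerProductSpace ℂ K]
    {π : C₀(X, ℂ) → K →L[ℂ] K} (D : CompatMetric (OnePoint X)) (S : ℝ → K →L[ℂ] K) :
    PropDecayPlus π D S ↔ SmallSuppPlus π S := by
  constructor
  · intro h U hU hdiag
    obtain ⟨ε, hε, hεU⟩ := D.exists_lt_mem_of_diagonal hU hdiag
    obtain ⟨t₀, ht₀⟩ := h (ε / 2) (by positivity)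
    refine ⟨max 1 t₀, le_max_left _ _, fun t ht p hp => hεU p ?_⟩
    have := ht₀ t ((le_max_right _ _).trans ht.le) p hp
    linarith
  · intro h ε hε
    obtain ⟨tU, -, htU⟩ := h {q | D.d q.1 q.2 < ε} (isOpen_lt D.continuous continuous_const)
      fun z => by simpa [D.refl] using hε
    refine ⟨tU + 1, fun t ht p hp => ?_⟩
    have h1 : D.d p.1 p.2 < ε := htU t (by linarith) hp
    exact h1.le

lemma commDecay_of_smallSuppPlus [T2Space X] [LocallyCompactSpace X] (hπ : IsStarRep π)
    {S : ℝ → H →L[ℂ] H} (hS : OpBdd S) (h : SmallSuppPlus π S) : CommDecay π S := by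
  obtain ⟨C, hC⟩ := hS
  refine (commDecay_iff hπ S).2 fun f => tendsto_norm_commutator (onePointRep hπ) ?_
    (eventually_atTop.2 ⟨1, hC⟩) f
  intro g f hgf
  obtain ⟨tU, -, htU⟩ := h (tsupport ⇑g ×ˢ tsupport ⇑f)ᶜ
    ((isClosed_tsupport g).prod (isClosed_tsupport f)).isOpen_compl
    fun z hz => Set.disjoint_left.1 hgf hz.1 hz.2
  filter_upwards [eventually_gt_atTop tU] with t ht
  exact mul_mul_eq_zero_of_disjoint_opSupportPlus hπ fun y hy x hx hyx =>
    htU t ht hyx (Set.mk_mem_prod hy hx)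

lemma CommDecay.congr {S T : ℝ → H →L[ℂ] H} (hS : CommDecay π S)
    (hTS : Tendsto (fun t => ‖T t - S t‖) atTop (𝓝 0)) : CommDecay π T := by
  intro φ
  have h0 := tendsto_zero_iff_norm_tendsto_zero.2 hTS
  have h1 := tendsto_zero_iff_norm_tendsto_zero.2 (hS φ)
  have h2 := (h1.add (h0.const_mul (π φ))).sub (h0.mul_const (π φ))
  rw [mul_zero, zero_mul, add_zero, sub_zero] at h2
  refine tendsto_zero_iff_norm_tendsto_zero.1 (h2.congr fun t => ?_)
  rw [mul_sub, sub_mul]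
  simp only [ContinuousLinearMap.mul_def]
  abel

lemma ApproxBy.commDecay [T2Space X] [LocallyCompactSpace X] (hπ : IsStarRep π)
    {T : ℝ → H →L[ℂ] H} {cls val : (ℝ → H →L[ℂ] H) → Prop}
    (h : ApproxBy T cls val (SmallSuppPlus π)) : CommDecay π T := by
  obtain ⟨S, hS, -, -, hTS, hsupp⟩ := h
  exact (commDecay_of_smallSuppPlus hπ hS hsupp).congr hTS

/-- A family asymptotic to a uniformly continuous one on `[1, ∞)` is uniformly continuous. -/
lemma uniformContinuousOn_of_tendsto_sub {E : Type*} [NormedAddCommGroup E] {S T : ℝ → E}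
    (hS : ContinuousOn S (Set.Ici 1)) (hT : UniformContinuousOn T (Set.Ici 1))
    (h : Tendsto (fun t => S t - T t) atTop (𝓝 0)) : UniformContinuousOn S (Set.Ici 1) := by
  let u : ℝ → E := fun t => S (max 1 |t|) - T (max 1 |t|)
  have hmem : ∀ t : ℝ, max 1 |t| ∈ Set.Ici (1 : ℝ) := fun t => Set.mem_Ici.2 (le_max_left _ _)
  have hm : Continuous fun t : ℝ => max 1 |t| := by fun_prop
  have hu : Continuous u := (hS.comp_continuous hm hmem).sub
    (hT.continuousOn.comp_continuous hm hmem)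
  have hlim : Tendsto u (cocompact ℝ) (𝓝 0) := by
    refine h.comp (tendsto_atTop_mono (fun t => le_max_right 1 |t|) ?_)
    exact tendsto_norm_cocompact_atTop
  have hu' := (hu.uniformContinuous_of_tendsto_cocompact hlim).uniformContinuousOn
    (s := Set.Ici (1 : ℝ))
  rw [uniformContinuousOn_iff_restrict] at hT hu' ⊢
  convert hT.add hu' using 1
  ext ⟨t, ht⟩
  have ht1 : max 1 |t| = t := by
    have : (1 : ℝ) ≤ t := ht
    rw [abs_of_nonneg (by linarith), max_eq_right this]
  simp [u, ht1]

lemma CommDecay.exists_approx [T2Space X] [LocallyCompactSpace X] (hπ : IsStarRep π)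
    (D : CompatMetric (OnePoint X)) {T : ℝ → H →L[ℂ] H} (hb : OpBdd T)
    (hT : ContinuousOn T (Set.Ici 1)) (hcomm : CommDecay π T) :
    ∃ S : ℝ → H →L[ℂ] H, OpBdd S ∧ ContinuousOn S (Set.Ici 1) ∧
      (UniformContinuousOn T (Set.Ici 1) → UniformContinuousOn S (Set.Ici 1)) ∧
      ((∀ t : ℝ, 1 ≤ t → IsCompactOperator ⇑(T t)) →
        ∀ t : ℝ, 1 ≤ t → IsCompactOperator ⇑(S t)) ∧
      Tendsto (fun t => ‖T t - S t‖) atTop (𝓝 0) ∧ PropDecayPlus π D S := by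
  let T' : ℝ → H →L[ℂ] H := fun t => T (max 1 t)
  have hT' : Continuous T' :=
    hT.comp_continuous (by fun_prop) fun t => Set.mem_Ici.2 (le_max_left _ _)
  have heq : ∀ t : ℝ, 1 ≤ t → T' t = T t := fun t ht => by simp only [T', max_eq_right ht]
  have hev : T' =ᶠ[atTop] T := (eventually_ge_atTop 1).mono heq
  obtain ⟨S, hSc, hSK, hS1, hS0, hSD⟩ := exists_controlled_approx (onePointRep hπ) D hT' fun f =>
    ((commDecay_iff hπ T).1 hcomm f).congr' (hev.mono fun t ht => by simp only [ht])
  have hlim : Tendsto (fun t => S t - T t) atTop (𝓝 0) :=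
    hS0.congr' (hev.mono fun t ht => by simp only [ht])
  refine ⟨S, ?_, hSc.continuousOn,
    fun hu => uniformContinuousOn_of_tendsto_sub hSc.continuousOn hu hlim,
    fun hK t ht => hSK t (by rw [heq t ht]; exact hK t ht), ?_, fun ε hε => ?_⟩
  · obtain ⟨C, hC⟩ := hb
    refine ⟨1 + C, fun t ht => ?_⟩
    have h1 := hS1 t
    rw [heq t ht] at h1
    calc ‖S t‖ = ‖(S t - T t) + T t‖ := by rw [sub_add_cancel]
      _ ≤ 1 + C := (norm_add_le _ _).trans (add_le_add h1 (hC t ht))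
  · simpa only [norm_sub_rev] using tendsto_zero_iff_norm_tendsto_zero.1 hlim
  · obtain ⟨t₀, ht₀⟩ := eventually_atTop.1 (hSD ε hε)
    exact ⟨t₀, fun t ht p hp => dist_le_of_mem_opSupportPlus hπ (ht₀ t ht) hp⟩

/-- The equivalences for continuity and value classes inherited by the approximants of
`CommDecay.exists_approx`. -/
lemma commDecay_iff_approxBy [T2Space X] [LocallyCompactSpace X] (hπ : IsStarRep π)
    (D : CompatMetric (OnePoint X)) {T : ℝ → H →L[ℂ] H} (hb : OpBdd T)
    (hT : ContinuousOn T (Set.Ici 1)) {cls val : (ℝ → H →L[ℂ] H) → Prop}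
    (hcls : ∀ S, ContinuousOn S (Set.Ici 1) →
      (UniformContinuousOn T (Set.Ici 1) → UniformContinuousOn S (Set.Ici 1)) → cls S)
    (hval : ∀ S : ℝ → H →L[ℂ] H, ((∀ t : ℝ, 1 ≤ t → IsCompactOperator ⇑(T t)) →
        ∀ t : ℝ, 1 ≤ t → IsCompactOperator ⇑(S t)) → val S) :
    (CommDecay π T ↔ ApproxBy T cls val (PropDecayPlus π D)) ∧
      (CommDecay π T ↔ ApproxBy T cls val (SmallSuppPlus π)) := by
  have h23 : PropDecayPlus π D = SmallSuppPlus π :=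
    funext fun S => propext (propDecayPlus_iff_smallSuppPlus D S)
  rw [← h23, and_self]
  refine ⟨fun h => ?_, fun h => ApproxBy.commDecay hπ (h23 ▸ h)⟩
  obtain ⟨S, hSb, hSc, hSu, hSK, hlim, hprop⟩ := h.exists_approx hπ D hb hT
  exact ⟨S, hSb, hcls S hSc hSu, hval S hSK, hlim, hprop⟩

end OnePointRep

/-- for a second countable, locally compact Hausdorff space `X`, an `X`-module
`H` and a compatible metric `D` on the one-point compactification `X⁺`, and for any bounded
norm-continuous operator family `T` on `[1, ∞)`, the conditions
(1) vanishing commutators with `C₀(X)`,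
(2) approximability by a family whose propagation (w.r.t. `D`) tends to `0`, and
(3) approximability by a family whose supports eventually lie in any given neighbourhood of
the diagonal of `X⁺ × X⁺`
are equivalent; and the same equivalences hold in the uniformly continuous, the
compact-operator valued, and the uniformly continuous compact-operator valued settings. -/
theorem statement0
    {X : Type*} [TopologicalSpace X] [T2Space X] [LocallyCompactSpace X]
    [SecondCountableTopology X]
    {H : Type*} [NormedAddCommGroup H] [InnerProductSpace ℂ H] [CompleteSpace H]
    [SecondCountableTopology H]
    (π : C₀(X, ℂ) → H →L[ℂ] H) (hπ : IsStarRep π)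
    (D : CompatMetric (OnePoint X)) :
    -- bounded norm-continuous 𝓛(H)-valued functions
    (∀ T : ℝ → H →L[ℂ] H, OpBdd T → ContinuousOn T (Set.Ici 1) →
      ((CommDecay π T ↔
          ApproxBy T (fun S => ContinuousOn S (Set.Ici 1)) (fun _ => True)
            (PropDecayPlus π D)) ∧
       (CommDecay π T ↔
          ApproxBy T (fun S => ContinuousOn S (Set.Ici 1)) (fun _ => True)
            (SmallSuppPlus π)))) ∧
    -- bounded uniformly norm-continuous 𝓛(H)-valued functions
    (∀ T : ℝ → H →L[ℂ] H, OpBdd T → UniformContinuousOn T (Set.Ici 1) →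
      ((CommDecay π T ↔
          ApproxBy T (fun S => UniformContinuousOn S (Set.Ici 1)) (fun _ => True)
            (PropDecayPlus π D)) ∧
       (CommDecay π T ↔
          ApproxBy T (fun S => UniformContinuousOn S (Set.Ici 1)) (fun _ => True)
            (SmallSuppPlus π)))) ∧
    -- bounded norm-continuous 𝒦(H)-valued functions
    (∀ T : ℝ → H →L[ℂ] H, OpBdd T → ContinuousOn T (Set.Ici 1) →
      (∀ t : ℝ, 1 ≤ t → IsCompactOperator ⇑(T t)) →
      ((CommDecay π T ↔
          ApproxBy T (fun S => ContinuousOn S (Set.Ici 1))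
            (fun S => ∀ t : ℝ, 1 ≤ t → IsCompactOperator ⇑(S t))
            (PropDecayPlus π D)) ∧
       (CommDecay π T ↔
          ApproxBy T (fun S => ContinuousOn S (Set.Ici 1))
            (fun S => ∀ t : ℝ, 1 ≤ t → IsCompactOperator ⇑(S t))
            (SmallSuppPlus π)))) ∧
    -- bounded uniformly norm-continuous 𝒦(H)-valued functions
    (∀ T : ℝ → H →L[ℂ] H, OpBdd T → UniformContinuousOn T (Set.Ici 1) →
      (∀ t : ℝ, 1 ≤ t → IsCompactOperator ⇑(T t)) →
      ((CommDecay π T ↔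
          ApproxBy T (fun S => UniformContinuousOn S (Set.Ici 1))
            (fun S => ∀ t : ℝ, 1 ≤ t → IsCompactOperator ⇑(S t))
            (PropDecayPlus π D)) ∧
       (CommDecay π T ↔
          ApproxBy T (fun S => UniformContinuousOn S (Set.Ici 1))
            (fun S => ∀ t : ℝ, 1 ≤ t → IsCompactOperator ⇑(S t))
            (SmallSuppPlus π)))) := by
  refine ⟨fun T hb hT => ?_, fun T hb hT => ?_, fun T hb hT hK => ?_, fun T hb hT hK => ?_⟩
  · exact commDecay_iff_approxBy hπ D hb hT (fun _ h _ => h) fun _ _ => trivial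
  · exact commDecay_iff_approxBy hπ D hb hT.continuousOn (fun _ _ h => h hT) fun _ _ => trivial
  · exact commDecay_iff_approxBy hπ D hb hT (fun _ h _ => h) fun _ h => h hK
  · exact commDecay_iff_approxBy hπ D hb hT.continuousOn (fun _ _ h => h hT) fun _ h => h hK

end Stmt
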